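/- arXiv:1009.4720 — 3 statements merged into one kernel-verified Lean document; each statement's English description precedes it below -/
import Mathlib

section
/- Let V, H : ℤ → ℕ be functions such that V is nonincreasing, H is nondecreasing, there exists g ∈ ℕ with V(k) = 0 for all k ≥ g and H(k) = 0 for all k ≤ −g, V(k) → ∞ as k → −∞, and H(k) → ∞ as k → +∞. Let p, q be coprime integers with p > 0 and q > 0, and let i be an integer with 0 ≤ i ≤ p−1. Then the map D = D_{i,p/q} : ⊕_{s∈ℤ} T⁺ → ⊕_{s∈ℤ} T⁺ is surjective. -/
/-- `T⁺ = 𝔽₂[U,U⁻¹]/U·𝔽₂[U]`, modeled as finitely supported functions `ℕ → 𝔽₂`. -/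
abbrev Tplus : Type := ℕ →₀ ZMod 2

/-- The action of `U^m` on `T⁺`: `(U^m f)(n) = f(n + m)`. -/
noncomputable def Upow (m : ℕ) : Tplus →ₗ[ZMod 2] Tplus :=
  Finsupp.lcomapDomain (· + m) (add_left_injective m)

open Filter

theorem Upow_apply (m : ℕ) (f : Tplus) (n : ℕ) : Upow m f n = f (n + m) := rfl

theorem Upow_surjective (m : ℕ) : Function.Surjective (Upow m) := fun f =>
  ⟨f.mapDomain (· + m), by
    ext n
    rw [Upow_apply]
    exact Finsupp.mapDomain_apply (add_left_injective m) f n⟩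

/-- A one-sided chain of equations `U^{v n} a_{n+1} + U^{h n} a_n = b_n` has an eventually
vanishing solution with any prescribed initial value. -/
theorem exists_eventually_zero_solution (v h : ℕ → ℕ) (b : ℕ → Tplus) (x : Tplus)
    (hv : ∀ᶠ n in atTop, v n = 0) (hh : Tendsto h atTop atTop)
    (hb : ∀ᶠ n in atTop, b n = 0) :
    ∃ a : ℕ → Tplus, a 0 = x ∧ (∀ n, Upow (v n) (a (n + 1)) + Upow (h n) (a n) = b n) ∧
      ∀ᶠ n in atTop, a n = 0 := by
  choose R hR using Upow_surjective
  let a : ℕ → Tplus := fun n => Nat.rec x (fun k y => R (v k) (b k - Upow (h k) y)) n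
  have step (n : ℕ) : Upow (v n) (a (n + 1)) + Upow (h n) (a n) = b n := by
    change Upow (v n) (R (v n) (b n - Upow (h n) (a n))) + _ = _
    rw [hR, sub_add_cancel]
  refine ⟨a, rfl, step, ?_⟩
  obtain ⟨N, hN⟩ := eventually_atTop.1 (hv.and hb)
  have next (n : ℕ) (hn : N ≤ n) (k : ℕ) : a (n + 1) k = -a n (k + h n) := by
    have e := DFunLike.congr_fun (step n) k
    rw [(hN n hn).1, (hN n hn).2, Finsupp.add_apply, Upow_apply, Upow_apply] at e
    exact eq_neg_of_add_eq_zero_left e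
  obtain ⟨d, hd⟩ : ∃ d, ∀ k, d ≤ k → a N k = 0 := by
    refine ⟨(a N).support.sup id + 1, fun k hk => ?_⟩
    by_contra hne
    have := Finset.le_sup (f := id) (Finsupp.mem_support_iff.2 hne)
    simp only [id] at this
    omega
  have bounded (n : ℕ) (hn : N ≤ n) : ∀ k, d ≤ k → a n k = 0 := by
    induction n, hn using Nat.le_induction with
    | base => exact hd
    | succ n hn ih =>
      intro k hk
      rw [next n hn, ih _ (by omega), neg_zero]
  have large : ∀ᶠ n in atTop, a (n + 1) = 0 := by
    filter_upwards [hh.eventually_ge_atTop d, eventually_ge_atTop N] with n hdn hn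
    ext k
    rw [next n hn, bounded n hn _ (by omega), neg_zero, Finsupp.zero_apply]
  rw [← map_add_atTop_eq_nat 1]
  exact eventually_map.2 large

theorem Finsupp.eventually_int_eq_zero {M : Type*} [Zero M] (b : ℤ →₀ M) :
    (∀ᶠ s in atTop, b s = 0) ∧ ∀ᶠ s in atBot, b s = 0 := by
  have h : ∀ᶠ s in cofinite, b s = 0 := b.hasFiniteSupport
  rwa [Int.cofinite_eq, eventually_sup, and_comm] at h

theorem Finsupp.exists_eq_of_eventually_int_eq_zero {M : Type*} [Zero M] (a : ℤ → M)
    (ht : ∀ᶠ s in atTop, a s = 0) (hb : ∀ᶠ s in atBot, a s = 0) :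
    ∃ f : ℤ →₀ M, ∀ s, f s = a s := by
  have h : ∀ᶠ s in cofinite, a s = 0 := by
    rw [Int.cofinite_eq, eventually_sup]
    exact ⟨hb, ht⟩
  exact ⟨Finsupp.ofSupportFinite a h, fun _ => rfl⟩

/-- The two-sided system `U^{v s} a_s + U^{h (s-1)} a_{s-1} = b_s` has a finitely supported
solution. -/
theorem exists_two_sided_solution (v h : ℤ → ℕ)
    (hv : ∀ᶠ s in atTop, v s = 0) (hh : ∀ᶠ s in atBot, h s = 0)
    (hvt : Tendsto v atBot atTop) (hht : Tendsto h atTop atTop) (b : ℤ →₀ Tplus) :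
    ∃ a : ℤ →₀ Tplus, ∀ s, Upow (v s) (a s) + Upow (h (s - 1)) (a (s - 1)) = b s := by
  have cast : Tendsto (fun n : ℕ => (n : ℤ)) atTop atTop := tendsto_natCast_atTop_atTop
  have castSucc : Tendsto (fun n : ℕ => (n : ℤ) + 1) atTop atTop :=
    tendsto_atTop_add_const_right _ _ cast
  have castNeg : Tendsto (fun n : ℕ => -(n : ℤ)) atTop atBot :=
    tendsto_neg_atTop_atBot.comp cast
  have castNegPred : Tendsto (fun n : ℕ => -(n : ℤ) - 1) atTop atBot :=
    tendsto_atBot_add_const_right _ _ castNeg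
  obtain ⟨r, r0, hr, rz⟩ := exists_eventually_zero_solution (fun n => v (n + 1)) (fun n => h n)
    (fun n => b (n + 1)) 0 (castSucc.eventually hv) (hht.comp cast)
    (castSucc.eventually b.eventually_int_eq_zero.1)
  obtain ⟨l, l0, hl, lz⟩ := exists_eventually_zero_solution (fun n => h (-n - 1))
    (fun n => v (-n)) (fun n => b (-n)) 0 (castNegPred.eventually hh) (hvt.comp castNeg)
    (castNeg.eventually b.eventually_int_eq_zero.2)
  have toNat : Tendsto Int.toNat atTop atTop :=
    tendsto_atTop.2 fun n => by
      filter_upwards [eventually_ge_atTop (n : ℤ)] with s hs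
      omega
  obtain ⟨a, ha⟩ := Finsupp.exists_eq_of_eventually_int_eq_zero
    (fun s : ℤ => if 0 ≤ s then r s.toNat else l (-s).toNat)
    (by
      filter_upwards [toNat.eventually rz, eventually_ge_atTop 0] with s hs h0
      rw [if_pos h0, hs])
    (by
      filter_upwards [(toNat.comp tendsto_neg_atBot_atTop).eventually lz,
        eventually_lt_atBot 0] with s hs h0
      rw [if_neg (by omega)]
      exact hs)
  have aR (n : ℕ) : a n = r n := by simp [ha]
  have aL (n : ℕ) : a (-n) = l n := by
    rcases n.eq_zero_or_pos with rfl | hn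
    · simp [ha, r0, l0]
    · rw [ha, if_neg (by omega)]
      simp
  refine ⟨a, fun s => ?_⟩
  rcases lt_or_ge 0 s with hs | hs
  · obtain ⟨n, rfl⟩ : ∃ n : ℕ, s = n + 1 := ⟨(s - 1).toNat, by omega⟩
    have e := hr n
    rw [← aR, ← aR] at e
    simpa using e
  · obtain ⟨n, rfl⟩ : ∃ n : ℕ, s = -n := ⟨(-s).toNat, by omega⟩
    have e := hl n
    rw [← aL, ← aL, add_comm] at e
    rwa [show -((n + 1 : ℕ) : ℤ) = -n - 1 by push_cast; ring] at e

theorem tendsto_floor_affine_div (p q i : ℤ) (hp : 0 < p) (hq : 0 < q) :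
    Tendsto (fun s : ℤ => ⌊((i : ℚ) + (p : ℚ) * (s : ℚ)) / (q : ℚ)⌋) atTop atTop ∧
      Tendsto (fun s : ℤ => ⌊((i : ℚ) + (p : ℚ) * (s : ℚ)) / (q : ℚ)⌋) atBot atBot := by
  have hp' : (0 : ℚ) < p := mod_cast hp
  have hq' : (0 : ℚ) < q := mod_cast hq
  constructor
  · exact tendsto_floor_atTop.comp <| (tendsto_atTop_add_const_left _ _ <|
      tendsto_intCast_atTop_atTop.const_mul_atTop hp').atTop_div_const hq'
  · exact tendsto_floor_atBot.comp <| (tendsto_atBot_add_const_left _ _ <|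
      ((tendsto_intCast_atBot_iff (R := ℚ)).2 tendsto_id).const_mul_atBot hp').atBot_div_const hq'

/-- Surjectivity of the map `D^T_{i,p/q} : ⊕_{s∈ℤ} T⁺ → ⊕_{s∈ℤ} T⁺` of the rational surgery
mapping cone, `(D a)_s = U^{V(⌊(i+ps)/q⌋)}(a_s) + U^{H(⌊(i+p(s-1))/q⌋)}(a_{s-1})`, for a
positive slope `p/q > 0` (the abstract form of Lemma 2.7 of Ni–Wu). -/
theorem D_surjective_of_pos_slope
    (V H : ℤ → ℕ) (hV : Antitone V) (hH : Monotone H)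
    (g : ℕ) (hVg : ∀ k : ℤ, (g : ℤ) ≤ k → V k = 0) (hHg : ∀ k : ℤ, k ≤ -(g : ℤ) → H k = 0)
    (hVtop : Filter.Tendsto V Filter.atBot Filter.atTop)
    (hHtop : Filter.Tendsto H Filter.atTop Filter.atTop)
    (p q : ℤ) (hp : 0 < p) (hq : 0 < q) (hpq : Int.gcd p q = 1)
    (i : ℤ) (hi0 : 0 ≤ i) (hip : i ≤ p - 1)
    (D : (ℤ →₀ Tplus) →ₗ[ZMod 2] (ℤ →₀ Tplus))
    (hD : ∀ (a : ℤ →₀ Tplus) (s : ℤ),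
      D a s = Upow (V ⌊((i : ℚ) + (p : ℚ) * (s : ℚ)) / (q : ℚ)⌋) (a s)
        + Upow (H ⌊((i : ℚ) + (p : ℚ) * ((s : ℚ) - 1)) / (q : ℚ)⌋) (a (s - 1))) :
    Function.Surjective D := by
  obtain ⟨ft, fb⟩ := tendsto_floor_affine_div p q i hp hq
  intro b
  obtain ⟨a, ha⟩ := exists_two_sided_solution
    (fun s => V ⌊((i : ℚ) + (p : ℚ) * (s : ℚ)) / (q : ℚ)⌋)
    (fun s => H ⌊((i : ℚ) + (p : ℚ) * (s : ℚ)) / (q : ℚ)⌋)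
    ((ft.eventually_ge_atTop (g : ℤ)).mono fun s hs => hVg _ hs)
    ((fb.eventually_le_atBot (-(g : ℤ))).mono fun s hs => hHg _ hs)
    (hVtop.comp fb) (hHtop.comp ft) b
  refine ⟨a, Finsupp.ext fun s => ?_⟩
  rw [hD, ← ha s]
  push_cast
  rfl
end

section
/- Let V, H : ℤ → ℕ be functions such that V is nonincreasing, H is nondecreasing, V(0) = H(0) = 0, V(k) → ∞ as k → −∞, and H(k) → ∞ as k → +∞. Let p, q be coprime integers with p > 0 and q > 0, and let i be an integer with 0 ≤ i ≤ p−1. Define σ : T⁺ → ⊕_{s∈ℤ} T⁺ by σ(ξ)_0 = σ(ξ)_{−1} = ξ, σ(ξ)_s = U^{H(⌊(i+p(s−1))/q⌋)}(σ(ξ)_{s−1}) for s > 0, and σ(ξ)_s = U^{V(⌊(i+p(s+1))/q⌋)}(σ(ξ)_{s+1}) for s < −1 (under the stated hypotheses σ(ξ) is finitely supported, so σ is well defined). Then σ is an injective 𝔽₂-linear map satisfying σ∘U = U∘σ (where U acts on ⊕_{s∈ℤ} T⁺ componentwise), and the kernel of D = D_{i,p/q} is exactly the image of σ; in particular, the kernel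 of D is isomorphic to T⁺ compatibly with the U-action. -/
theorem Upow_zero (f : Tplus) : Upow 0 f = f := by
  ext n
  simp [Upow]

theorem Upow_comm (m n : ℕ) (f : Tplus) : Upow m (Upow n f) = Upow n (Upow m f) := by
  ext k
  simp [Upow, add_right_comm]

/-- A two-sided family determined recursively by its values at `-1` and `0` is unique. -/
theorem eq_of_recursion_away_from_zero {α : Type*} {f g : ℤ → α → α} {a b : ℤ → α}
    (h0 : a 0 = b 0) (h1 : a (-1) = b (-1))
    (ha : ∀ s, 0 < s → a s = f s (a (s - 1))) (hb : ∀ s, 0 < s → b s = f s (b (s - 1)))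
    (ha' : ∀ s, s < -1 → a s = g s (a (s + 1))) (hb' : ∀ s, s < -1 → b s = g s (b (s + 1))) :
    a = b := by
  funext s
  rcases le_or_gt 0 s with hs | hs
  · induction s, hs using Int.leInduction with
    | base => exact h0
    | succ n hn ih =>
      rw [ha _ (by lia), hb _ (by lia), add_sub_cancel_right, ih]
  · have hs' : s ≤ -1 := by lia
    clear hs
    induction s, hs' using Int.leInductionDown with
    | base => exact h1
    | pred n hn ih =>
      rw [ha' _ (by lia), hb' _ (by lia), sub_add_cancel, ih]

/-- For a positive slope `p/q > 0` and `V₀ = H₀ = 0`, the map `σ : T⁺ → ⊕_{s∈ℤ} T⁺` defined by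
`σ(ξ)₀ = σ(ξ)₋₁ = ξ`, `σ(ξ)_s = U^{H(⌊(i+p(s-1))/q⌋)}(σ(ξ)_{s-1})` for `s > 0` and
`σ(ξ)_s = U^{V(⌊(i+p(s+1))/q⌋)}(σ(ξ)_{s+1})` for `s < -1`, is an injective `𝔽₂`-linear
`U`-equivariant map whose image is exactly the kernel of `D = D^T_{i,p/q}`; in particular the
kernel of `D` is a copy of `T⁺`, compatibly with the `U`-action (the abstract form of the
positive-slope case of Lemma 5.2 of Ni–Wu). -/
theorem sigma_injective_range_eq_ker_D_of_pos_slope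
    (V H : ℤ → ℕ) (hV : Antitone V) (hH : Monotone H)
    (hV0 : V 0 = 0) (hH0 : H 0 = 0)
    (hVtop : Filter.Tendsto V Filter.atBot Filter.atTop)
    (hHtop : Filter.Tendsto H Filter.atTop Filter.atTop)
    (p q : ℤ) (hp : 0 < p) (hq : 0 < q) (hpq : Int.gcd p q = 1)
    (i : ℤ) (hi0 : 0 ≤ i) (hip : i ≤ p - 1)
    (D : (ℤ →₀ Tplus) →ₗ[ZMod 2] (ℤ →₀ Tplus))
    (hD : ∀ (a : ℤ →₀ Tplus) (s : ℤ),
      D a s = Upow (V ⌊((i : ℚ) + (p : ℚ) * (s : ℚ)) / (q : ℚ)⌋) (a s)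
        + Upow (H ⌊((i : ℚ) + (p : ℚ) * ((s : ℚ) - 1)) / (q : ℚ)⌋) (a (s - 1)))
    (σ : Tplus → (ℤ →₀ Tplus))
    (hσ0 : ∀ ξ : Tplus, σ ξ 0 = ξ)
    (hσneg1 : ∀ ξ : Tplus, σ ξ (-1) = ξ)
    (hσpos : ∀ (ξ : Tplus) (s : ℤ), 0 < s →
      σ ξ s = Upow (H ⌊((i : ℚ) + (p : ℚ) * ((s : ℚ) - 1)) / (q : ℚ)⌋) (σ ξ (s - 1)))
    (hσneg : ∀ (ξ : Tplus) (s : ℤ), s < -1 →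
      σ ξ s = Upow (V ⌊((i : ℚ) + (p : ℚ) * ((s : ℚ) + 1)) / (q : ℚ)⌋) (σ ξ (s + 1))) :
    Function.Injective σ ∧
    (∀ ξ η : Tplus, σ (ξ + η) = σ ξ + σ η) ∧
    (∀ (c : ZMod 2) (ξ : Tplus), σ (c • ξ) = c • σ ξ) ∧
    (∀ ξ : Tplus, σ (Upow 1 ξ) = Finsupp.mapRange (Upow 1) (map_zero _) (σ ξ)) ∧
    {a : ℤ →₀ Tplus | D a = 0} = Set.range σ := by
  set v : ℤ → ℕ := fun s => V ⌊((i : ℚ) + (p : ℚ) * (s : ℚ)) / (q : ℚ)⌋ with hv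
  set h : ℤ → ℕ := fun s => H ⌊((i : ℚ) + (p : ℚ) * (s : ℚ)) / (q : ℚ)⌋ with hh
  have hqQ : (0 : ℚ) < q := by exact_mod_cast hq
  have hv0 : ∀ s, 0 ≤ s → v s = 0 := by
    intro s hs
    have hfloor : 0 ≤ ⌊((i : ℚ) + (p : ℚ) * (s : ℚ)) / (q : ℚ)⌋ := by
      rw [Int.floor_nonneg]
      have : (0 : ℚ) ≤ i + p * s := by exact_mod_cast add_nonneg hi0 (mul_nonneg hp.le hs)
      positivity
    exact Nat.le_zero.mp (hV0 ▸ hV hfloor)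
  have hh0 : ∀ s, s < 0 → h s = 0 := by
    intro s hs
    have hfloor : ⌊((i : ℚ) + (p : ℚ) * (s : ℚ)) / (q : ℚ)⌋ ≤ 0 := by
      apply Int.floor_nonpos
      have : (i : ℚ) + p * s ≤ 0 := by
        have : i + p * s ≤ 0 := by nlinarith
        exact_mod_cast this
      exact div_nonpos_of_nonpos_of_nonneg this hqQ.le
    exact Nat.le_zero.mp (hH0 ▸ hH hfloor)
  replace hD : ∀ (a : ℤ →₀ Tplus) (s : ℤ),
      D a s = Upow (v s) (a s) + Upow (h (s - 1)) (a (s - 1)) := by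
    intro a s
    simp only [hD, hv, hh, Int.cast_sub, Int.cast_one]
  replace hσpos : ∀ (ξ : Tplus) (s : ℤ), 0 < s →
      σ ξ s = Upow (h (s - 1)) (σ ξ (s - 1)) := by
    intro ξ s hs
    simp only [hσpos ξ s hs, hh, Int.cast_sub, Int.cast_one]
  replace hσneg : ∀ (ξ : Tplus) (s : ℤ), s < -1 →
      σ ξ s = Upow (v (s + 1)) (σ ξ (s + 1)) := by
    intro ξ s hs
    simp only [hσneg ξ s hs, hv, Int.cast_add, Int.cast_one]
  have eq_σ : ∀ (ξ : Tplus) (a : ℤ →₀ Tplus), a 0 = ξ → a (-1) = ξ →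
      (∀ s, 0 < s → a s = Upow (h (s - 1)) (a (s - 1))) →
      (∀ s, s < -1 → a s = Upow (v (s + 1)) (a (s + 1))) → σ ξ = a := by
    intro ξ a ha0 ha1 hapos haneg
    exact DFunLike.coe_injective <| eq_of_recursion_away_from_zero
      (f := fun s => Upow (h (s - 1))) (g := fun s => Upow (v (s + 1)))
      ((hσ0 ξ).trans ha0.symm) ((hσneg1 ξ).trans ha1.symm) (hσpos ξ) hapos (hσneg ξ) haneg
  refine ⟨fun ξ η hξη => ?_, fun ξ η => ?_, fun c ξ => ?_, fun ξ => ?_, ?_⟩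
  · rw [← hσ0 ξ, hξη, hσ0]
  · refine eq_σ _ _ ?_ ?_ (fun s hs => ?_) (fun s hs => ?_)
    · simp only [Finsupp.add_apply, hσ0]
    · simp only [Finsupp.add_apply, hσneg1]
    · rw [Finsupp.add_apply, Finsupp.add_apply, map_add, ← hσpos _ _ hs, ← hσpos _ _ hs]
    · rw [Finsupp.add_apply, Finsupp.add_apply, map_add, ← hσneg _ _ hs, ← hσneg _ _ hs]
  · refine eq_σ _ _ ?_ ?_ (fun s hs => ?_) (fun s hs => ?_)
    · rw [Finsupp.smul_apply, hσ0]
    · rw [Finsupp.smul_apply, hσneg1]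
    · rw [Finsupp.smul_apply, Finsupp.smul_apply, map_smul, ← hσpos _ _ hs]
    · rw [Finsupp.smul_apply, Finsupp.smul_apply, map_smul, ← hσneg _ _ hs]
  · refine eq_σ _ _ ?_ ?_ (fun s hs => ?_) (fun s hs => ?_)
    · rw [Finsupp.mapRange_apply, hσ0]
    · rw [Finsupp.mapRange_apply, hσneg1]
    · rw [Finsupp.mapRange_apply, Finsupp.mapRange_apply, Upow_comm, ← hσpos _ _ hs]
    · rw [Finsupp.mapRange_apply, Finsupp.mapRange_apply, Upow_comm, ← hσneg _ _ hs]
  · have add_eq_zero_iff : ∀ x y : Tplus, x + y = 0 ↔ x = y := fun x y => by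
      rw [add_eq_zero_iff_eq_neg, ZModModule.neg_eq_self]
    have mem_ker_iff : ∀ a : ℤ →₀ Tplus, D a = 0 ↔
        ∀ s, Upow (v s) (a s) = Upow (h (s - 1)) (a (s - 1)) := fun a => by
      simp only [DFunLike.ext_iff (f := D a), hD, Finsupp.coe_zero, Pi.zero_apply,
        add_eq_zero_iff]
    ext a
    rw [Set.mem_ofPred_eq, mem_ker_iff]
    constructor
    · intro ha
      refine ⟨a 0, eq_σ _ _ rfl ?_ (fun s hs => ?_) (fun s hs => ?_)⟩
      · have := ha 0
        rw [hv0 0 le_rfl, hh0 _ (by lia), Upow_zero, Upow_zero] at this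
        exact this.symm
      · rw [← ha s, hv0 s hs.le, Upow_zero]
      · rw [ha (s + 1), add_sub_cancel_right, hh0 s (by lia), Upow_zero]
    · rintro ⟨ξ, rfl⟩ s
      rcases lt_trichotomy s 0 with hs | rfl | hs
      · rw [hh0 _ (by lia), Upow_zero, hσneg ξ (s - 1) (by lia), sub_add_cancel]
      · rw [hv0 0 le_rfl, hh0 _ (by lia), Upow_zero, Upow_zero, hσ0, zero_sub, hσneg1]
      · rw [hv0 s hs.le, Upow_zero, hσpos ξ s hs]
end

section
/- Let V, H : ℤ → ℕ be given by V(k) = max(−k, 0) and H(k) = max(k, 0). Let p, q be coprime integers with p > 0 and q > 0, and let i be an integer with 0 ≤ i ≤ p−1. Define ι : T⁺ → ⊕_{s∈ℤ} T⁺ by ι(ξ)_0 = ι(ξ)_{−1} = ξ, ι(ξ)_s = U^{⌊(i+p(s−1))/q⌋}(ι(ξ)_{s−1}) for s > 0, and ι(ξ)_s = U^{−⌊(i+p(s+1))/q⌋}(ι(ξ)_{s+1}) for s < −1 (the exponents are nonnegative integers, and ι(ξ) is finitely supported, so ι is well defined). Then ι is an injective 𝔽₂-linear map whose image is exactly the kernel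 of D = D_{i,p/q}. -/
theorem Upow_zero_apply (ξ : Tplus) : Upow 0 ξ = ξ := by
  ext n
  simp [Upow, Finsupp.lcomapDomain]

/-- A family satisfying a two-sided recursion starting from `0` and `-1` is determined by
its value at `0`. -/
theorem eq_of_recursion {M : Type*} {a b : ℤ → M} (F G : ℤ → M → M)
    (ha0 : a (-1) = a 0) (hb0 : b (-1) = b 0)
    (haF : ∀ s, 0 < s → a s = F s (a (s - 1))) (hbF : ∀ s, 0 < s → b s = F s (b (s - 1)))
    (haG : ∀ s, s < -1 → a s = G s (a (s + 1))) (hbG : ∀ s, s < -1 → b s = G s (b (s + 1)))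
    (h : a 0 = b 0) : a = b := by
  funext s
  rcases le_or_gt 0 s with hs | hs
  · induction s, hs using Int.leInduction with
    | base => exact h
    | succ n hn ih =>
      rw [haF _ (by omega), hbF _ (by omega), add_sub_cancel_right, ih]
  · have hs' : s ≤ -1 := by omega
    clear hs
    induction s, hs' using Int.leInductionDown with
    | base => rw [ha0, hb0, h]
    | pred n hn ih =>
      rw [haG _ (by omega), hbG _ (by omega), sub_add_cancel, ih]

/-- For the unknot values `V(k) = max(-k,0)`, `H(k) = max(k,0)` and a positive slope
`p/q > 0`, the map `ι : T⁺ → ⊕_{s∈ℤ} T⁺` defined by `ι(ξ)₀ = ι(ξ)₋₁ = ξ`,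
`ι(ξ)_s = U^{⌊(i+p(s-1))/q⌋}(ι(ξ)_{s-1})` for `s > 0` and
`ι(ξ)_s = U^{-⌊(i+p(s+1))/q⌋}(ι(ξ)_{s+1})` for `s < -1`, is an injective `𝔽₂`-linear map
whose image is exactly the kernel of `D = D_{i,p/q}`; the kernel of `D` computes
`HF⁺(L(p,q), i)` (the computation in Section 2.1 of Ni–Wu). -/
theorem iota_injective_range_eq_ker_D_unknot
    (V H : ℤ → ℕ) (hVdef : ∀ k : ℤ, V k = (-k).toNat) (hHdef : ∀ k : ℤ, H k = k.toNat)
    (p q : ℤ) (hp : 0 < p) (hq : 0 < q) (hpq : Int.gcd p q = 1)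
    (i : ℤ) (hi0 : 0 ≤ i) (hip : i ≤ p - 1)
    (D : (ℤ →₀ Tplus) →ₗ[ZMod 2] (ℤ →₀ Tplus))
    (hD : ∀ (a : ℤ →₀ Tplus) (s : ℤ),
      D a s = Upow (V ⌊((i : ℚ) + (p : ℚ) * (s : ℚ)) / (q : ℚ)⌋) (a s)
        + Upow (H ⌊((i : ℚ) + (p : ℚ) * ((s : ℚ) - 1)) / (q : ℚ)⌋) (a (s - 1)))
    (ι : Tplus → (ℤ →₀ Tplus))
    (hι0 : ∀ ξ : Tplus, ι ξ 0 = ξ)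
    (hιneg1 : ∀ ξ : Tplus, ι ξ (-1) = ξ)
    (hιpos : ∀ (ξ : Tplus) (s : ℤ), 0 < s →
      ι ξ s = Upow (⌊((i : ℚ) + (p : ℚ) * ((s : ℚ) - 1)) / (q : ℚ)⌋).toNat (ι ξ (s - 1)))
    (hιneg : ∀ (ξ : Tplus) (s : ℤ), s < -1 →
      ι ξ s = Upow (-⌊((i : ℚ) + (p : ℚ) * ((s : ℚ) + 1)) / (q : ℚ)⌋).toNat (ι ξ (s + 1))) :
    Function.Injective ι ∧
    (∀ ξ η : Tplus, ι (ξ + η) = ι ξ + ι η) ∧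
    (∀ (c : ZMod 2) (ξ : Tplus), ι (c • ξ) = c • ι ξ) ∧
    Set.range ι = {a : ℤ →₀ Tplus | D a = 0} := by
  have hcast_sub (s : ℤ) : (s : ℚ) - 1 = ((s - 1 : ℤ) : ℚ) := by push_cast; rfl
  have hcast_add (s : ℤ) : (s : ℚ) + 1 = ((s + 1 : ℤ) : ℚ) := by push_cast; rfl
  simp only [hVdef, hHdef, hcast_sub] at hD
  simp only [hcast_sub] at hιpos
  simp only [hcast_add] at hιneg
  have hqQ : (0 : ℚ) < q := by exact_mod_cast hq
  have hfloor_nonneg (s : ℤ) (hs : 0 ≤ s) : 0 ≤ ⌊((i : ℚ) + (p : ℚ) * (s : ℚ)) / (q : ℚ)⌋ := by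
    have : 0 ≤ i + p * s := by positivity
    exact Int.floor_nonneg.2 (div_nonneg (by exact_mod_cast this) hqQ.le)
  have hfloor_neg (s : ℤ) (hs : s ≤ -1) : ⌊((i : ℚ) + (p : ℚ) * (s : ℚ)) / (q : ℚ)⌋ < 0 := by
    have : i + p * s < 0 := by nlinarith
    rw [Int.floor_lt, Int.cast_zero]
    exact div_neg_of_neg_of_pos (by exact_mod_cast this) hqQ
  generalize hf : (fun s : ℤ => ⌊((i : ℚ) + (p : ℚ) * (s : ℚ)) / (q : ℚ)⌋) = f at *
  replace hf (s : ℤ) : ⌊((i : ℚ) + (p : ℚ) * (s : ℚ)) / (q : ℚ)⌋ = f s := congrFun hf s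
  simp only [hf] at hD hιpos hιneg hfloor_nonneg hfloor_neg
  have hker (a : ℤ →₀ Tplus) : D a = 0 ↔ a (-1) = a 0 ∧
      (∀ s, 0 < s → a s = Upow (f (s - 1)).toNat (a (s - 1))) ∧
      (∀ s, s < -1 → a s = Upow (-f (s + 1)).toNat (a (s + 1))) := by
    have hD_zero : D a 0 = a 0 + a (-1) := by
      have h0 := hfloor_nonneg 0 le_rfl
      have h1 := hfloor_neg (-1) le_rfl
      rw [hD, zero_sub, Int.toNat_of_nonpos (by omega : -f 0 ≤ 0),
        Int.toNat_of_nonpos h1.le, Upow_zero_apply, Upow_zero_apply]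
    have hD_pos (s : ℤ) (hs : 0 < s) : D a s = a s + Upow (f (s - 1)).toNat (a (s - 1)) := by
      have h0 := hfloor_nonneg s hs.le
      rw [hD, Int.toNat_of_nonpos (by omega : -f s ≤ 0), Upow_zero_apply]
    have hD_neg (s : ℤ) (hs : s < -1) :
        D a (s + 1) = Upow (-f (s + 1)).toNat (a (s + 1)) + a s := by
      have h1 := hfloor_neg s hs.le
      rw [hD, add_sub_cancel_right, Int.toNat_of_nonpos h1.le, Upow_zero_apply]
    have hadd (x y : Tplus) : x + y = 0 ↔ x = y := by
      rw [add_eq_zero_iff_eq_neg, ZModModule.neg_eq_self]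
    constructor
    · intro h
      refine ⟨?_, fun s hs => ?_, fun s hs => ?_⟩
      · exact ((hadd _ _).1 (by rw [← hD_zero, h]; rfl)).symm
      · exact (hadd _ _).1 (by rw [← hD_pos s hs, h]; rfl)
      · exact ((hadd _ _).1 (by rw [← hD_neg s hs, h]; rfl)).symm
    · rintro ⟨h0, hpos, hneg⟩
      refine Finsupp.ext fun s => ?_
      rw [Finsupp.zero_apply]
      rcases lt_trichotomy s 0 with hs | rfl | hs
      · have := hD_neg (s - 1) (by omega)
        rw [hneg (s - 1) (by omega), sub_add_cancel] at this
        rw [this, hadd]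
      · rw [hD_zero, hadd, h0]
      · rw [hD_pos s hs, hadd, ← hpos s hs]
  have hmem (ξ : Tplus) : D (ι ξ) = 0 :=
    (hker _).2 ⟨by rw [hι0, hιneg1], hιpos ξ, hιneg ξ⟩
  have huniq (a b : ℤ →₀ Tplus) (ha : D a = 0) (hb : D b = 0) (h : a 0 = b 0) : a = b := by
    obtain ⟨ha0, haF, haG⟩ := (hker a).1 ha
    obtain ⟨hb0, hbF, hbG⟩ := (hker b).1 hb
    exact DFunLike.coe_injective (eq_of_recursion (fun s => Upow (f (s - 1)).toNat)
      (fun s => Upow (-f (s + 1)).toNat) ha0 hb0 haF hbF haG hbG h)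
  refine ⟨fun ξ η h => ?_, fun ξ η => ?_, fun c ξ => ?_, Set.ext fun a => ⟨?_, fun ha => ?_⟩⟩
  · rw [← hι0 ξ, h, hι0]
  · exact huniq _ _ (hmem _) (by rw [map_add, hmem, hmem, add_zero])
      (by rw [Finsupp.add_apply, hι0, hι0, hι0])
  · exact huniq _ _ (hmem _) (by rw [map_smul, hmem, smul_zero])
      (by rw [Finsupp.smul_apply, hι0, hι0])
  · rintro ⟨ξ, rfl⟩
    exact hmem ξ
  · exact ⟨a 0, huniq _ _ (hmem _) ha (hι0 _)⟩
end
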